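/- arXiv:1206.3730 — 4 statements merged into one kernel-verified Lean document; each statement's English description precedes it below -/
import Mathlib

section
/- Let a, b, c : ℝ² → ℝ be smooth functions solving system (2). Then for any s ∈ ℝ, the functions ã(x,t) = a(x, t·e^{−s}), b̃(x,t) = e^{2s}·b(x, t·e^{−s}), c̃(x,t) = e^{s}·c(x, t·e^{−s}) also solve system (2). -/
/-- Partial derivative with respect to the first coordinate `x`. -/
noncomputable def pdx (f : ℝ × ℝ → ℝ) (p : ℝ × ℝ) : ℝ := fderiv ℝ f p (1, 0)

/-- Partial derivative with respect to the second coordinate `t`. -/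
noncomputable def pdt (f : ℝ × ℝ → ℝ) (p : ℝ × ℝ) : ℝ := fderiv ℝ f p (0, 1)

/-- The six equations of system (2) (Einstein equations of a 4-dimensional
Walker manifold whose defining functions depend only on `x`, `t`), at a point `p`. -/
def EinsteinWalkerAt (a b c : ℝ × ℝ → ℝ) (p : ℝ × ℝ) : Prop :=
  pdx (pdx a) p - pdt (pdt b) p = 0 ∧
  pdt (pdx b) p + pdx (pdx c) p = 0 ∧
  pdt (pdx a) p + pdt (pdt c) p = 0 ∧
  pdx a p * pdt c p + pdt a p * pdt b p - pdt a p * pdx c p - (pdt c p) ^ 2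
    + 2 * c p * pdt (pdx a) p + b p * pdt (pdt a) p - a p * pdt (pdx c) p = 0 ∧
  pdt a p * pdx b p - pdx c p * pdt c p + c p * pdx (pdx a) p - a p * pdx (pdx c) p
    - c p * pdt (pdx c) p - b p * pdt (pdt c) p = 0 ∧
  pdx a p * pdx b p - pdx b p * pdt c p + pdt b p * pdx c p - (pdx c p) ^ 2
    + a p * pdx (pdx b) p + 2 * c p * pdt (pdx b) p - b p * pdt (pdx c) p = 0

theorem hasFDerivAt_const_mul_scale {f : ℝ × ℝ → ℝ} (hf : Differentiable ℝ f) (k r : ℝ)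
    (p : ℝ × ℝ) :
    HasFDerivAt (fun q : ℝ × ℝ => k * f (q.1, q.2 * r))
      (k • (fderiv ℝ f (p.1, p.2 * r)).comp
        ((ContinuousLinearMap.fst ℝ ℝ ℝ).prod (r • ContinuousLinearMap.snd ℝ ℝ ℝ))) p :=
  ((hf (p.1, p.2 * r)).hasFDerivAt.comp p
    (hasFDerivAt_fst.prodMk (hasFDerivAt_snd.mul_const r))).const_mul k

theorem pdx_const_mul_scale {f : ℝ × ℝ → ℝ} (hf : Differentiable ℝ f) (k r : ℝ) :
    pdx (fun q => k * f (q.1, q.2 * r)) = fun q => k * pdx f (q.1, q.2 * r) := by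
  funext p
  simp [pdx, (hasFDerivAt_const_mul_scale hf k r p).fderiv]

theorem pdt_const_mul_scale {f : ℝ × ℝ → ℝ} (hf : Differentiable ℝ f) (k r : ℝ) :
    pdt (fun q => k * f (q.1, q.2 * r)) = fun q => (k * r) * pdt f (q.1, q.2 * r) := by
  funext p
  have h : ((0 : ℝ), r) = r • ((0 : ℝ), (1 : ℝ)) := by simp
  simp only [pdt, (hasFDerivAt_const_mul_scale hf k r p).fderiv]
  simp [h, mul_assoc, -Prod.smul_mk]

theorem differentiable_pdx {f : ℝ × ℝ → ℝ} (hf : ContDiff ℝ (⊤ : ℕ∞) f) :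
    Differentiable ℝ (pdx f) :=
  ((hf.fderiv_right (m := 1) (by norm_cast)).clm_apply contDiff_const).differentiable (by simp)

theorem differentiable_pdt {f : ℝ × ℝ → ℝ} (hf : ContDiff ℝ (⊤ : ℕ∞) f) :
    Differentiable ℝ (pdt f) :=
  ((hf.fderiv_right (m := 1) (by norm_cast)).clm_apply contDiff_const).differentiable (by simp)

/-- Scaling symmetry `g₆(s)`: if `(a,b,c)` is a smooth solution of system (2),
so is `(a(x,te⁻ˢ), e²ˢ b(x,te⁻ˢ), eˢ c(x,te⁻ˢ))`. -/
theorem g6_invariance (a b c : ℝ × ℝ → ℝ)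
    (ha : ContDiff ℝ (⊤ : ℕ∞) a) (hb : ContDiff ℝ (⊤ : ℕ∞) b) (hc : ContDiff ℝ (⊤ : ℕ∞) c)
    (h : ∀ p, EinsteinWalkerAt a b c p) (s : ℝ) :
    ∀ p, EinsteinWalkerAt
      (fun q => a (q.1, q.2 * Real.exp (-s)))
      (fun q => Real.exp (2 * s) * b (q.1, q.2 * Real.exp (-s)))
      (fun q => Real.exp s * c (q.1, q.2 * Real.exp (-s))) p := by
  intro p
  have ha₀ := ha.differentiable (by simp)
  have hb₀ := hb.differentiable (by simp)
  have hc₀ := hc.differentiable (by simp)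
  have hk : Real.exp s * Real.exp (-s) = 1 := by rw [← Real.exp_add]; simp
  have hk₂ : Real.exp (2 * s) = Real.exp s ^ 2 := by rw [← Real.exp_nat_mul]; norm_num
  have ha₁ : (fun q : ℝ × ℝ => a (q.1, q.2 * Real.exp (-s))) =
      fun q => 1 * a (q.1, q.2 * Real.exp (-s)) := by simp
  obtain ⟨h₁, h₂, h₃, h₄, h₅, h₆⟩ := h (p.1, p.2 * Real.exp (-s))
  rw [ha₁, hk₂]
  clear hk₂ ha₁
  generalize Real.exp (-s) = r at *
  generalize Real.exp s = k at *
  simp only [EinsteinWalkerAt, pdx_const_mul_scale, pdt_const_mul_scale, ha₀, hb₀, hc₀,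
    differentiable_pdx, differentiable_pdt, ha, hb, hc]
  set q := (p.1, p.2 * r)
  refine ⟨?_, ?_, ?_, ?_, ?_, ?_⟩
  · linear_combination h₁ - pdt (pdt b) q * (k * r + 1) * hk
  · linear_combination k * h₂ + k * pdt (pdx b) q * hk
  · linear_combination r * h₃ + r * pdt (pdt c) q * hk
  · linear_combination h₄ + (pdx a q * pdt c q + pdt a q * pdt b q * (k * r + 1)
      - pdt a q * pdx c q - pdt c q ^ 2 * (k * r + 1) + 2 * c q * pdt (pdx a) q
      + b q * pdt (pdt a) q * (k * r + 1) - a q * pdt (pdx c) q) * hk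
  · linear_combination k * h₅ + k * (pdt a q * pdx b q - pdx c q * pdt c q
      - c q * pdt (pdx c) q - b q * pdt (pdt c) q * (k * r + 1)) * hk
  · linear_combination k ^ 2 * h₆ + k ^ 2 * (pdt b q * pdx c q - pdx b q * pdt c q
      + 2 * c q * pdt (pdx b) q - b q * pdt (pdx c) q) * hk
end

section
/- Let a, b, c : ℝ² → ℝ be smooth functions solving system (2). Then for any s ∈ ℝ, the functions ã(x,t) = s²·b(x−st, t) + 2s·c(x−st, t) + a(x−st, t), b̃(x,t) = b(x−st, t), c̃(x,t) = s·b(x−st, t) + c(x−st, t) also solve system (2). -/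
lemma ContDiff.pdx {f : ℝ × ℝ → ℝ} (hf : ContDiff ℝ (⊤ : ℕ∞) f) : ContDiff ℝ (⊤ : ℕ∞) (pdx f) :=
  (hf.fderiv_right (m := (⊤ : ℕ∞)) (by simp)).clm_apply contDiff_const

lemma ContDiff.pdt {f : ℝ × ℝ → ℝ} (hf : ContDiff ℝ (⊤ : ℕ∞) f) : ContDiff ℝ (⊤ : ℕ∞) (pdt f) :=
  (hf.fderiv_right (m := (⊤ : ℕ∞)) (by simp)).clm_apply contDiff_const

lemma pdx_pdt_comm {f : ℝ × ℝ → ℝ} (hf : ContDiff ℝ (⊤ : ℕ∞) f) (p : ℝ × ℝ) :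
    pdx (pdt f) p = pdt (pdx f) p := by
  have hd : DifferentiableAt ℝ (fderiv ℝ f) p :=
    ((hf.fderiv_right (m := (⊤ : ℕ∞)) (by simp)).differentiable (by simp)) p
  have key (v w : ℝ × ℝ) :
      fderiv ℝ (fun q => fderiv ℝ f q v) p w = fderiv ℝ (fderiv ℝ f) p w v := by
    simp [fderiv_clm_apply hd (differentiableAt_const v)]
  have hs : IsSymmSndFDerivAt ℝ f p :=
    hf.contDiffAt.isSymmSndFDerivAt 
      (by rw [minSmoothness_of_isRCLikeNormedField]; exact WithTop.coe_le_coe.2 le_top)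
  exact (key _ _).trans ((hs.eq _ _).trans (key _ _).symm)

lemma hasFDerivAt_shear (s : ℝ) (p : ℝ × ℝ) :
    HasFDerivAt (fun q : ℝ × ℝ => (q.1 - s * q.2, q.2))
      ((ContinuousLinearMap.fst ℝ ℝ ℝ - s • ContinuousLinearMap.snd ℝ ℝ ℝ).prod
        (ContinuousLinearMap.snd ℝ ℝ ℝ)) p :=
  (hasFDerivAt_fst.sub (hasFDerivAt_snd.const_mul s)).prodMk hasFDerivAt_snd

lemma contDiff_comp_shear {f : ℝ × ℝ → ℝ} (hf : ContDiff ℝ (⊤ : ℕ∞) f) (s : ℝ) :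
    ContDiff ℝ (⊤ : ℕ∞) (fun q : ℝ × ℝ => f (q.1 - s * q.2, q.2)) :=
  hf.comp (by fun_prop)

lemma pdx_comp_shear {f : ℝ × ℝ → ℝ} (hf : ContDiff ℝ (⊤ : ℕ∞) f) (s : ℝ) :
    pdx (fun q => f (q.1 - s * q.2, q.2)) = fun q => pdx f (q.1 - s * q.2, q.2) := by
  funext p
  have hd := (hf.differentiable (by simp) (p.1 - s * p.2, p.2)).hasFDerivAt
  have := (hd.comp p (hasFDerivAt_shear s p)).fderiv
  simp only [Function.comp_def] at this
  simp [pdx, this]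

lemma pdt_comp_shear {f : ℝ × ℝ → ℝ} (hf : ContDiff ℝ (⊤ : ℕ∞) f) (s : ℝ) :
    pdt (fun q => f (q.1 - s * q.2, q.2)) =
      fun q => pdt f (q.1 - s * q.2, q.2) + -s * pdx f (q.1 - s * q.2, q.2) := by
  funext p
  have hd := (hf.differentiable (by simp) (p.1 - s * p.2, p.2)).hasFDerivAt
  have := (hd.comp p (hasFDerivAt_shear s p)).fderiv
  simp only [Function.comp_def] at this
  have hv : ((-s, 1) : ℝ × ℝ) = (0, 1) + (-s) • (1, 0) := by simp
  simp only [pdt, pdx, this, ContinuousLinearMap.comp_apply, ContinuousLinearMap.prod_apply,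
    sub_apply, smul_apply, ContinuousLinearMap.coe_fst',
    ContinuousLinearMap.coe_snd', smul_eq_mul, mul_one, zero_sub, hv, map_add, map_smul]

lemma pdx_add {f g : ℝ × ℝ → ℝ} (hf : ContDiff ℝ (⊤ : ℕ∞) f) (hg : ContDiff ℝ (⊤ : ℕ∞) g) :
    pdx (fun q => f q + g q) = fun q => pdx f q + pdx g q := by
  funext p
  simp [pdx, fderiv_fun_add (hf.differentiable (by simp) p) (hg.differentiable (by simp) p)]

lemma pdt_add {f g : ℝ × ℝ → ℝ} (hf : ContDiff ℝ (⊤ : ℕ∞) f) (hg : ContDiff ℝ (⊤ : ℕ∞) g) :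
    pdt (fun q => f q + g q) = fun q => pdt f q + pdt g q := by
  funext p
  simp [pdt, fderiv_fun_add (hf.differentiable (by simp) p) (hg.differentiable (by simp) p)]

lemma pdx_const_mul {f : ℝ × ℝ → ℝ} (hf : ContDiff ℝ (⊤ : ℕ∞) f) (k : ℝ) :
    pdx (fun q => k * f q) = fun q => k * pdx f q := by
  funext p
  simp [pdx, fderiv_const_mul (hf.differentiable (by simp) p)]

lemma pdt_const_mul {f : ℝ × ℝ → ℝ} (hf : ContDiff ℝ (⊤ : ℕ∞) f) (k : ℝ) :
    pdt (fun q => k * f q) = fun q => k * pdt f q := by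
  funext p
  simp [pdt, fderiv_const_mul (hf.differentiable (by simp) p)]

lemma pdt_pdt_comp_shear {f : ℝ × ℝ → ℝ} (hf : ContDiff ℝ (⊤ : ℕ∞) f) (s : ℝ) :
    pdt (pdt (fun q => f (q.1 - s * q.2, q.2))) = fun q =>
      pdt (pdt f) (q.1 - s * q.2, q.2) - 2 * s * pdt (pdx f) (q.1 - s * q.2, q.2)
        + s ^ 2 * pdx (pdx f) (q.1 - s * q.2, q.2) := by
  have hx := contDiff_comp_shear hf.pdx s
  rw [pdt_comp_shear hf, pdt_add (contDiff_comp_shear hf.pdt s) (contDiff_const.mul hx),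
    pdt_const_mul hx, pdt_comp_shear hf.pdt, pdt_comp_shear hf.pdx]
  funext p
  simp only [pdx_pdt_comm hf]
  ring

/-- Symmetry `g₅(s)`: if `(a,b,c)` is a smooth solution of system (2), so is
`(s²b(x−st,t) + 2sc(x−st,t) + a(x−st,t), b(x−st,t), sb(x−st,t) + c(x−st,t))`. -/
theorem g5_invariance (a b c : ℝ × ℝ → ℝ)
    (ha : ContDiff ℝ (⊤ : ℕ∞) a) (hb : ContDiff ℝ (⊤ : ℕ∞) b) (hc : ContDiff ℝ (⊤ : ℕ∞) c)
    (h : ∀ p, EinsteinWalkerAt a b c p) (s : ℝ) :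
    ∀ p, EinsteinWalkerAt
      (fun q => s ^ 2 * b (q.1 - s * q.2, q.2) + 2 * s * c (q.1 - s * q.2, q.2)
        + a (q.1 - s * q.2, q.2))
      (fun q => b (q.1 - s * q.2, q.2))
      (fun q => s * b (q.1 - s * q.2, q.2) + c (q.1 - s * q.2, q.2)) p := by
  intro p
  have hA := contDiff_comp_shear ha s
  have hB := contDiff_comp_shear hb s
  have hC := contDiff_comp_shear hc s
  have mul {f : ℝ × ℝ → ℝ} (hf : ContDiff ℝ (⊤ : ℕ∞) f) (k : ℝ) :
      ContDiff ℝ (⊤ : ℕ∞) (fun q => k * f q) := contDiff_const.mul hf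
  have pdx_c {k : ℝ} {f g : ℝ × ℝ → ℝ} (hf : ContDiff ℝ (⊤ : ℕ∞) f) (hg : ContDiff ℝ (⊤ : ℕ∞) g) :
      pdx (fun q => k * f q + g q) = fun q => k * pdx f q + pdx g q := by
    rw [pdx_add (mul hf k) hg, pdx_const_mul hf]
  have pdt_c {k : ℝ} {f g : ℝ × ℝ → ℝ} (hf : ContDiff ℝ (⊤ : ℕ∞) f) (hg : ContDiff ℝ (⊤ : ℕ∞) g) :
      pdt (fun q => k * f q + g q) = fun q => k * pdt f q + pdt g q := by
    rw [pdt_add (mul hf k) hg, pdt_const_mul hf]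
  obtain ⟨h1, h2, h3, h4, h5, h6⟩ := h (p.1 - s * p.2, p.2)
  have hCA := (mul hC (2 * s)).add hA
  simp only [EinsteinWalkerAt, add_assoc, pdx_c hB hCA, pdx_c hC hA, pdx_c hB hC,
    pdt_c hB hCA, pdt_c hC hA, pdt_c hB hC,
    pdx_c hB.pdx hC.pdx, pdx_c hC.pdx hA.pdx, pdt_c hC.pdx hA.pdx, pdt_c hB.pdx hC.pdx,
    pdt_c hB.pdt hC.pdt, pdt_c hC.pdt hA.pdt,
    pdx_c hB.pdx ((mul hC.pdx (2 * s)).add hA.pdx),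
    pdt_c hB.pdx ((mul hC.pdx (2 * s)).add hA.pdx),
    pdt_c hB.pdt ((mul hC.pdt (2 * s)).add hA.pdt)]
  simp only [pdt_pdt_comp_shear ha, pdt_pdt_comp_shear hb, pdt_pdt_comp_shear hc]
  simp only [pdx_comp_shear ha, pdx_comp_shear hb, pdx_comp_shear hc,
    pdx_comp_shear ha.pdx, pdx_comp_shear hb.pdx, pdx_comp_shear hc.pdx,
    pdt_comp_shear ha, pdt_comp_shear hb, pdt_comp_shear hc,
    pdt_comp_shear ha.pdx, pdt_comp_shear hb.pdx, pdt_comp_shear hc.pdx]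
  have e1 := sub_eq_zero.mp h1
  have e2 := eq_neg_of_add_eq_zero_right h2
  have e3 := eq_neg_of_add_eq_zero_right h3
  simp only [e1, e2, e3] at h4 h5 h6 ⊢
  refine ⟨?_, ?_, ?_, ?_, ?_, ?_⟩
  · ring
  · ring
  · ring
  · linear_combination h4 - 2 * s * h5 + s ^ 2 * h6
  · linear_combination h5 - s * h6
  · linear_combination h6
end

section
/- On ℝ⁵ with coordinates (x,t,a,b,c), the vector fields X₁ = (1,0,0,0,0), X₂ = (0,1,0,0,0), X₃(x,t,a,b,c) = (x,0,0,−2b,−c), X₄(x,t,a,b,c) = (0,x,0,2c,a), X₅(x,t,a,b,c) = (t,0,2c,0,b), X₆(x,t,a,b,c) = (0,t,0,2b,c) satisfy the Lie bracket relations [X₁, X₃] = X₁, [X₁, X₄] = X₂, [X₂, X₅] = X₁, [X₂, X₆] = X₂, and [X₁, X₂] = [X₁, X₅] = [X₁, X₆] = [X₂, X₃] = [X₂, X₄] = 0. -/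
/-- `ℝ⁵` with coordinates `(x, t, a, b, c)`. -/
abbrev V5 := ℝ × ℝ × ℝ × ℝ × ℝ

/-- Lie bracket of vector fields on `ℝ⁵`:
`[V, W](p) = DW(p)(V(p)) − DV(p)(W(p))`. -/
noncomputable def lieBracketVF (V W : V5 → V5) : V5 → V5 :=
  fun p => fderiv ℝ W p (V p) - fderiv ℝ V p (W p)

def X1 : V5 → V5 := fun _ => (1, 0, 0, 0, 0)
def X2 : V5 → V5 := fun _ => (0, 1, 0, 0, 0)
def X3 : V5 → V5 := fun p => (p.1, 0, 0, -2 * p.2.2.2.1, -p.2.2.2.2)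
def X4 : V5 → V5 := fun p => (0, p.1, 0, 2 * p.2.2.2.2, p.2.2.1)
def X5 : V5 → V5 := fun p => (p.2.1, 0, 2 * p.2.2.2.2, 0, p.2.2.2.1)
def X6 : V5 → V5 := fun p => (0, p.2.1, 0, 2 * p.2.2.2.1, p.2.2.2.2)
def X7 : V5 → V5 := fun p => (0, 0, p.2.2.1, p.2.2.2.1, p.2.2.2.2)

/-- The bracket of a constant vector field with a linear one is constant. -/
lemma lieBracketVF_const_of_isLinearMap (v : V5) {W : V5 → V5} (hW : IsLinearMap ℝ W) :
    lieBracketVF (fun _ => v) W = fun _ => W v := by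
  funext p
  have h : fderiv ℝ W p v = W v :=
    congrArg (fun L : V5 →L[ℝ] V5 => L v) (LinearMap.toContinuousLinearMap (hW.mk' W)).fderiv
  simp [lieBracketVF, h]

lemma isLinearMap_X3 : IsLinearMap ℝ X3 := by
  constructor <;> intros <;> ext <;> simp [X3] <;> ring

lemma isLinearMap_X4 : IsLinearMap ℝ X4 := by
  constructor <;> intros <;> ext <;> simp [X4] <;> ring

lemma isLinearMap_X5 : IsLinearMap ℝ X5 := by
  constructor <;> intros <;> ext <;> simp [X5] <;> ring

lemma isLinearMap_X6 : IsLinearMap ℝ X6 := by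
  constructor <;> intros <;> ext <;> simp [X6] <;> ring

lemma lieBracketVF_X1_X2 : lieBracketVF X1 X2 = 0 := by
  unfold X1 X2
  funext p
  simp [lieBracketVF]

/-- Commutator relations involving the translations `X₁, X₂`. -/
theorem brackets_translations :
    lieBracketVF X1 X3 = X1 ∧ lieBracketVF X1 X4 = X2 ∧
    lieBracketVF X2 X5 = X1 ∧ lieBracketVF X2 X6 = X2 ∧
    lieBracketVF X1 X2 = 0 ∧ lieBracketVF X1 X5 = 0 ∧ lieBracketVF X1 X6 = 0 ∧
    lieBracketVF X2 X3 = 0 ∧ lieBracketVF X2 X4 = 0 := by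
  have h₁ {W : V5 → V5} (hW : IsLinearMap ℝ W) : lieBracketVF X1 W = fun _ => W (1, 0, 0, 0, 0) :=
    lieBracketVF_const_of_isLinearMap _ hW
  have h₂ {W : V5 → V5} (hW : IsLinearMap ℝ W) : lieBracketVF X2 W = fun _ => W (0, 1, 0, 0, 0) :=
    lieBracketVF_const_of_isLinearMap _ hW
  rw [h₁ isLinearMap_X3, h₁ isLinearMap_X4, h₂ isLinearMap_X5, h₂ isLinearMap_X6,
    h₁ isLinearMap_X5, h₁ isLinearMap_X6, h₂ isLinearMap_X3, h₂ isLinearMap_X4]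
  refine ⟨?_, ?_, ?_, ?_, lieBracketVF_X1_X2, ?_, ?_, ?_, ?_⟩ <;> funext p <;>
    simp [X1, X2, X3, X4, X5, X6]
end

section
/- Let r₁, r₂, r₃ ∈ ℝ. Then the functions a(x,t) = (r₁/2)x² + r₂x + r₃, b(x,t) = (r₁/2)t², c(x,t) = 0 satisfy all six equations of system (2) at every point (x,t) ∈ ℝ². -/
theorem pdx_comp_fst {f : ℝ → ℝ} {f' : ℝ → ℝ} (h : ∀ x, HasDerivAt f (f' x) x) :
    pdx (fun q => f q.1) = fun q => f' q.1 := by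
  funext p
  have hfst : HasFDerivAt Prod.fst (ContinuousLinearMap.fst ℝ ℝ ℝ) p := hasFDerivAt_fst
  have hf : HasFDerivAt (fun q : ℝ × ℝ => f q.1) _ p :=
    (h p.1).comp_hasFDerivAt p hfst
  simp [pdx, hf.fderiv]

theorem pdt_comp_fst {f : ℝ → ℝ} (h : Differentiable ℝ f) :
    pdt (fun q => f q.1) = fun _ => 0 := by
  funext p
  have hfst : HasFDerivAt Prod.fst (ContinuousLinearMap.fst ℝ ℝ ℝ) p := hasFDerivAt_fst
  have hf : HasFDerivAt (fun q : ℝ × ℝ => f q.1) _ p :=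
    (h p.1).hasDerivAt.comp_hasFDerivAt p hfst
  simp [pdt, hf.fderiv]

theorem pdt_comp_snd {f : ℝ → ℝ} {f' : ℝ → ℝ} (h : ∀ t, HasDerivAt f (f' t) t) :
    pdt (fun q => f q.2) = fun q => f' q.2 := by
  funext p
  have hsnd : HasFDerivAt Prod.snd (ContinuousLinearMap.snd ℝ ℝ ℝ) p := hasFDerivAt_snd
  have hf : HasFDerivAt (fun q : ℝ × ℝ => f q.2) _ p :=
    (h p.2).comp_hasFDerivAt p hsnd
  simp [pdt, hf.fderiv]

theorem pdx_comp_snd {f : ℝ → ℝ} (h : Differentiable ℝ f) :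
    pdx (fun q => f q.2) = fun _ => 0 := by
  funext p
  have hsnd : HasFDerivAt Prod.snd (ContinuousLinearMap.snd ℝ ℝ ℝ) p := hasFDerivAt_snd
  have hf : HasFDerivAt (fun q : ℝ × ℝ => f q.2) _ p :=
    (h p.2).hasDerivAt.comp_hasFDerivAt p hsnd
  simp [pdx, hf.fderiv]

theorem pdx_const (k : ℝ) : pdx (fun _ => k) = fun _ => 0 := by
  funext p
  simp [pdx]

theorem pdt_const (k : ℝ) : pdt (fun _ => k) = fun _ => 0 := by
  funext p
  simp [pdt]

theorem hasDerivAt_affine (m k x : ℝ) : HasDerivAt (fun y => m * y + k) m x := by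
  simpa using ((hasDerivAt_id x).const_mul m).add_const k

theorem hasDerivAt_quadratic (r m k x : ℝ) :
    HasDerivAt (fun y => r / 2 * y ^ 2 + m * y + k) (r * x + m) x := by
  have h := (((hasDerivAt_pow 2 x).const_mul (r / 2)).add
    ((hasDerivAt_id x).const_mul m)).add_const k
  refine h.congr_deriv ?_
  norm_num
  ring

/-- The group-invariant solution for `X₆`: `a = (r₁/2)x² + r₂x + r₃`,
`b = (r₁/2)t²`, `c = 0` solves system (2) everywhere. -/
theorem invariant_solution_X6 (r₁ r₂ r₃ : ℝ) :
    ∀ p : ℝ × ℝ,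
      EinsteinWalkerAt
        (fun q => r₁ / 2 * q.1 ^ 2 + r₂ * q.1 + r₃)
        (fun q => r₁ / 2 * q.2 ^ 2)
        (fun _ => 0) p := by
  intro p
  have hax := pdx_comp_fst (hasDerivAt_quadratic r₁ r₂ r₃)
  have haxx := pdx_comp_fst (hasDerivAt_affine r₁ r₂)
  have hat := pdt_comp_fst fun x => (hasDerivAt_quadratic r₁ r₂ r₃ x).differentiableAt
  have haxt := pdt_comp_fst fun x => (hasDerivAt_affine r₁ r₂ x).differentiableAt
  have hb : ∀ t, HasDerivAt (fun t : ℝ => r₁ / 2 * t ^ 2) (r₁ * t) t := by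
    simpa using hasDerivAt_quadratic r₁ 0 0
  have hb' : ∀ t, HasDerivAt (fun t : ℝ => r₁ * t) r₁ t := by
    simpa using hasDerivAt_affine r₁ 0
  have hbt := pdt_comp_snd hb
  have hbtt := pdt_comp_snd hb'
  have hbx := pdx_comp_snd fun t => (hb t).differentiableAt
  simp [EinsteinWalkerAt, hax, haxx, hat, haxt, hbt, hbtt, hbx, pdx_const, pdt_const]
end
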